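/- Let σ be a non-erasing, well-marked substitution over 𝔸 = {a,b} with A·B ≠ B·A, W_0 and T as in the context, and let ξ be a recurrent fixed point of σ. If W is a left special factor of ξ, then T(W) is a left special factor of ξ. -/

import Mathlib

namespace Subst

/-- `pow A m` is the `m`-fold concatenation `A^m`. -/
def pow (A : List Bool) : ℕ → List Bool
  | 0 => []
  | n + 1 => pow A n ++ A

/-- Membership in the submonoid of `𝔸*` generated by `{A, B}`. -/
inductive GenAB (A B : List Bool) : List Bool → Prop
  | nil : GenAB A B []
  | appA : ∀ {W}, GenAB A B W → GenAB A B (W ++ A)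
  | appB : ∀ {W}, GenAB A B W → GenAB A B (W ++ B)

/-- The extension of a substitution `σ : 𝔸 → 𝔸*` to a monoid morphism of `𝔸*`. -/
def subst (σ : Bool → List Bool) : List Bool → List Bool
  | [] => []
  | c :: w => σ c ++ subst σ w

/-- The factor `ξ[i, i+n)` of the infinite sequence `ξ`. -/
def wordAt (ξ : ℕ → Bool) (i n : ℕ) : List Bool :=
  (List.range n).map fun k => ξ (i + k)

/-- `W` is a factor of the infinite sequence `ξ`. -/
def IsFactor (ξ : ℕ → Bool) (W : List Bool) : Prop :=
  ∃ i, W = wordAt ξ i W.length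

/-- `ξ` is a fixed point of `σ`: for every `n`, `σ(ξ[0,n))` is a prefix of `ξ`. -/
def IsFixedPoint (σ : Bool → List Bool) (ξ : ℕ → Bool) : Prop :=
  ∀ n, subst σ (wordAt ξ 0 n) = wordAt ξ 0 (subst σ (wordAt ξ 0 n)).length

/-- `ξ` is recurrent: every factor occurs at infinitely many positions. -/
def Recurrent (ξ : ℕ → Bool) : Prop :=
  ∀ W, IsFactor ξ W → ∀ N, ∃ i, N ≤ i ∧ W = wordAt ξ i W.length

/-- `ξ` is ultimately periodic. -/
def UltPeriodic (ξ : ℕ → Bool) : Prop :=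
  ∃ p, 1 ≤ p ∧ ∃ N, ∀ n, N ≤ n → ξ (n + p) = ξ n

/-- `σ` is non-erasing: the image of each letter is nonempty. -/
def NonErasing (σ : Bool → List Bool) : Prop := ∀ c, σ c ≠ []

/-- `σ` is well-marked: `σ(c)` begins with the letter `c` for each letter `c`. -/
def WellMarked (σ : Bool → List Bool) : Prop := ∀ c, ∃ t, σ c = c :: t

/-- `σ` is primitive: for some `n ≥ 1`, each letter occurs in `σⁿ(d)` for each letter `d`. -/
def Primitive (σ : Bool → List Bool) : Prop :=
  ∃ n, 1 ≤ n ∧ ∀ c d : Bool, c ∈ (subst σ)^[n] [d]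

/-- `W` is a right special factor of `ξ`: both `Wa` and `Wb` are factors of `ξ`. -/
def RightSpecial (ξ : ℕ → Bool) (W : List Bool) : Prop :=
  ∀ c : Bool, IsFactor ξ (W ++ [c])

/-- `W` is a left special factor of `ξ`: both `aW` and `bW` are factors of `ξ`. -/
def LeftSpecial (ξ : ℕ → Bool) (W : List Bool) : Prop :=
  ∀ c : Bool, IsFactor ξ (c :: W)

/-- A right special factor is strong if all of `aWa, aWb, bWa, bWb` are factors. -/
def StrongSpecial (ξ : ℕ → Bool) (W : List Bool) : Prop :=
  ∀ c d : Bool, IsFactor ξ (c :: (W ++ [d]))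

/-- A right special factor is weak if neither `aW` nor `bW` is right special. -/
def WeakSpecial (ξ : ℕ → Bool) (W : List Bool) : Prop :=
  RightSpecial ξ W ∧ ∀ c : Bool, ¬ RightSpecial ξ (c :: W)

/-- The operator `T(W) = W₀ · σ(W)`. -/
def T (σ : Bool → List Bool) (W0 W : List Bool) : List Bool := W0 ++ subst σ W

/-- Specification of the word `W₀` (the longest common suffix of `A^∞` and `B^∞`)
together with the distinct letters `δ_a, δ_b`:  `δ_c · W₀` is a suffix of some power
of `σ(c)` for each letter `c`, and `δ_a ≠ δ_b`. -/
def W0Spec (σ : Bool → List Bool) (W0 : List Bool) (δ : Bool → Bool) : Prop :=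
  δ false ≠ δ true ∧ ∀ c, ∃ m, 1 ≤ m ∧ (δ c :: W0) <:+ pow (σ c) m

/-- The incidence matrix of `σ`: its columns are the Parikh vectors of `σ(a)` and `σ(b)`. -/
def incMat (σ : Bool → List Bool) : Matrix Bool Bool ℤ :=
  Matrix.of fun c d => ((σ d).count c : ℤ)

end Subst

open Subst

namespace Subst

theorem subst_append (σ : Bool → List Bool) (U V : List Bool) :
    subst σ (U ++ V) = subst σ U ++ subst σ V := by
  induction U with
  | nil => rfl
  | cons c U ih => simp [subst, ih]

theorem NonErasing.length_le_length_subst {σ : Bool → List Bool} (hne : NonErasing σ)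
    (U : List Bool) : U.length ≤ (subst σ U).length := by
  induction U with
  | nil => simp
  | cons c U ih =>
    have := List.length_pos_iff.mpr (hne c)
    simp only [subst, List.length_append, List.length_cons]
    omega

theorem length_wordAt (ξ : ℕ → Bool) (i n : ℕ) : (wordAt ξ i n).length = n := by
  simp [wordAt]

theorem wordAt_add (ξ : ℕ → Bool) (i m n : ℕ) :
    wordAt ξ i (m + n) = wordAt ξ i m ++ wordAt ξ (i + m) n := by
  simp [wordAt, List.range_add, Function.comp_def, Nat.add_assoc]

/-- A suffix of a prefix of `ξ` is a factor of `ξ`. -/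
theorem IsFactor.of_suffix_wordAt {ξ : ℕ → Bool} {V : List Bool} {n : ℕ}
    (h : V <:+ wordAt ξ 0 n) : IsFactor ξ V := by
  obtain ⟨U, hU⟩ := h
  have hn : n = U.length + V.length := by
    rw [← List.length_append, hU, length_wordAt]
  rw [hn, wordAt_add] at hU
  exact ⟨0 + U.length, (List.append_inj hU (length_wordAt ..).symm).2⟩

theorem pow_succ_eq_append (A : List Bool) (n : ℕ) : pow A (n + 1) = A ++ pow A n := by
  induction n with
  | zero => simp [pow]
  | succ n ih => exact (congrArg (· ++ A) ih).trans (List.append_assoc ..)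

/-- If `x · V` is a suffix of a power of a nonempty word `A`, it is also a suffix of `V · A`. -/
theorem cons_suffix_append_of_suffix_pow {A V : List Bool} {x : Bool} {m : ℕ} (hA : A ≠ [])
    (h : (x :: V) <:+ pow A m) : (x :: V) <:+ V ++ A := by
  have h₁ : (x :: V) <:+ pow A (m + 1) := by
    rw [pow_succ_eq_append]
    exact h.trans (List.suffix_append ..)
  have h₂ : V ++ A <:+ pow A (m + 1) := by
    obtain ⟨U, hU⟩ := (List.suffix_cons x V).trans h
    exact ⟨U, by rw [pow, ← hU, List.append_assoc]⟩
  refine List.suffix_of_suffix_length_le h₁ h₂ ?_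
  have := List.length_pos_iff.mpr hA
  simp only [List.length_append, List.length_cons]
  omega

theorem W0Spec.cons_suffix_append {σ : Bool → List Bool} {W0 : List Bool} {δ : Bool → Bool}
    (hW0 : W0Spec σ W0 δ) (hne : NonErasing σ) (c : Bool) : (δ c :: W0) <:+ W0 ++ σ c := by
  obtain ⟨m, -, h⟩ := hW0.2 c
  exact cons_suffix_append_of_suffix_pow (hne c) h

theorem _root_.List.IsSuffix.append_right {α : Type*} {U V : List α} (h : U <:+ V) (S : List α) :
    U ++ S <:+ V ++ S := by
  obtain ⟨R, rfl⟩ := h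
  exact ⟨R, by simp⟩

theorem W0Spec.suffix_append_subst {σ : Bool → List Bool} {W0 : List Bool} {δ : Bool → Bool}
    (hW0 : W0Spec σ W0 δ) (hne : NonErasing σ) (U : List Bool) : W0 <:+ W0 ++ subst σ U := by
  induction U with
  | nil => simp [subst]
  | cons c U ih =>
    have h := (List.suffix_cons _ _).trans (hW0.cons_suffix_append hne c)
    rw [subst, ← List.append_assoc]
    exact ih.trans (h.append_right _)

theorem W0Spec.suffix_subst {σ : Bool → List Bool} {W0 : List Bool} {δ : Bool → Bool}
    (hW0 : W0Spec σ W0 δ) (hne : NonErasing σ) {U : List Bool} (hU : W0.length ≤ U.length) :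
    W0 <:+ subst σ U :=
  List.suffix_of_suffix_length_le (hW0.suffix_append_subst hne U) (List.suffix_append ..)
    (hU.trans (hne.length_le_length_subst U))

theorem W0Spec.exists_eq {σ : Bool → List Bool} {W0 : List Bool} {δ : Bool → Bool}
    (hW0 : W0Spec σ W0 δ) (c : Bool) : ∃ d, δ d = c := by
  by_cases h : δ false = c
  · exact ⟨false, h⟩
  · refine ⟨true, ?_⟩
    have hδ := hW0.1
    revert h hδ
    cases δ false <;> cases δ true <;> cases c <;> simp

end Subst

/-- If `W` is a left special factor of the recurrent fixed point `ξ`,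
then so is `T(W)`. -/
theorem statement8 (σ : Bool → List Bool) (hne : NonErasing σ)
    (hwm : WellMarked σ)
    (hAB : σ false ++ σ true ≠ σ true ++ σ false)
    (W0 : List Bool) (δ : Bool → Bool) (hW0 : W0Spec σ W0 δ)
    (ξ : ℕ → Bool) (hfix : IsFixedPoint σ ξ) (hrec : Recurrent ξ)
    (W : List Bool) (hW : IsFactor ξ W) (hls : LeftSpecial ξ W) :
    LeftSpecial ξ (T σ W0 W) := by
  intro c
  obtain ⟨d, rfl⟩ := hW0.exists_eq c
  obtain ⟨i, hi, hdW⟩ := hrec _ (hls d) W0.length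
  have hpre := wordAt_add ξ 0 i (d :: W).length
  rw [Nat.zero_add, ← hdW] at hpre
  have hfac := hfix (i + (d :: W).length)
  rw [hpre, subst_append, subst, ← List.append_assoc] at hfac
  have hsuf := hW0.suffix_subst hne (U := wordAt ξ 0 i) (by rwa [length_wordAt])
  have hT := ((hW0.cons_suffix_append hne d).trans (hsuf.append_right _)).append_right (subst σ W)
  rw [hfac] at hT
  exact .of_suffix_wordAt hT
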